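/- If C is a self-dual Z2Z2[u]-cyclic code in R_{α,β}, then α = 2·t4 where t4 = deg d1(x) and d1(x) = gcd(f(x), ((x^β−1)/g(x))·l(x)); in particular α must be even. -/

import Mathlib

open TrivSqZeroExt

/-- The ring `R = Z₂ + uZ₂` with `u² = 0`. -/
abbrev R2 : Type := DualNumber (ZMod 2)

/-- The ambient space `Z₂^α × R^β`. -/
abbrev Amb (α β : ℕ) : Type := (Fin α → ZMod 2) × (Fin β → R2)

/-- Scalar multiplication of `R` on `Z₂^α × R^β`, where `R` acts on `Z₂`
through the quotient map killing `u`. -/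
def rsmul {α β : ℕ} (r : R2) (v : Amb α β) : Amb α β :=
  (fun i => r.fst * v.1 i, fun j => r * v.2 j)

/-- A `Z₂Z₂[u]`-linear code: a subset of `Z₂^α × R^β` closed under addition
and the `R`-action. -/
def IsLinearCode {α β : ℕ} (C : Set (Amb α β)) : Prop :=
  (0 : Amb α β) ∈ C ∧ (∀ v ∈ C, ∀ w ∈ C, v + w ∈ C) ∧ ∀ (r : R2), ∀ v ∈ C, rsmul r v ∈ C

/-- The inner product `⟨V,W⟩ = u·Σ aᵢdᵢ + Σ bⱼeⱼ ∈ R`. -/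
def innerP {α β : ℕ} (V W : Amb α β) : R2 :=
  DualNumber.eps * (inl (∑ i, V.1 i * W.1 i) : R2) + ∑ j, V.2 j * W.2 j

/-- The dual code. -/
def dualCode {α β : ℕ} (C : Set (Amb α β)) : Set (Amb α β) :=
  {W | ∀ V ∈ C, innerP V W = 0}

/-- The Gray map `Φ(x, r + uq) = (x, q, r + q)` into `Z₂^(α+2β)`. -/
def gray {α β : ℕ} (v : Amb α β) :
    (Fin α → ZMod 2) × (Fin β → ZMod 2) × (Fin β → ZMod 2) :=
  (v.1, fun j => (v.2 j).snd, fun j => (v.2 j).fst + (v.2 j).snd)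

/-- The simultaneous cyclic shift on `Z₂^α × R^β`. -/
def shiftT {α β : ℕ} [NeZero α] [NeZero β] (v : Amb α β) : Amb α β :=
  (fun i => v.1 (i - 1), fun j => v.2 (j - 1))

/-- A `Z₂Z₂[u]`-cyclic code: a linear code closed under the cyclic shift. -/
def IsCyclicCode {α β : ℕ} [NeZero α] [NeZero β] (C : Set (Amb α β)) : Prop :=
  IsLinearCode C ∧ ∀ v ∈ C, shiftT v ∈ C

/-- The cyclic code generated by a set of vectors. -/
def cyclicSpan {α β : ℕ} [NeZero α] [NeZero β] (G : Set (Amb α β)) : Set (Amb α β) :=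
  ⋂₀ {D | IsCyclicCode D ∧ G ⊆ D}

open Polynomial in
/-- The vector in `Z₂^n` of coefficients of `p mod (xⁿ − 1)`. -/
noncomputable def vecZ (n : ℕ) (p : Polynomial (ZMod 2)) : Fin n → ZMod 2 :=
  fun i => (p % (X ^ n - 1)).coeff i

open Polynomial in
/-- The vector in `R^n` corresponding to `g(x) + u·a(x)` modulo `xⁿ − 1`. -/
noncomputable def vecR (n : ℕ) (g a : Polynomial (ZMod 2)) : Fin n → R2 :=
  fun j => TrivSqZeroExt.inl ((g % (X ^ n - 1)).coeff j)
    + TrivSqZeroExt.inr ((a % (X ^ n - 1)).coeff j)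

open Polynomial in
theorem sd_monic (n : ℕ) [NeZero n] : (X ^ n - 1 : Polynomial (ZMod 2)).Monic := by
  simpa using monic_X_pow_sub_C (1 : ZMod 2) (NeZero.ne n)

open Polynomial in
theorem sd_degree (n : ℕ) [NeZero n] : (X ^ n - 1 : Polynomial (ZMod 2)).degree = n := by
  simpa using degree_X_pow_sub_C (Nat.pos_of_ne_zero (NeZero.ne n)) (1 : ZMod 2)

open Polynomial in
theorem vecZ_add (n : ℕ) (p q : Polynomial (ZMod 2)) :
    vecZ n (p + q) = vecZ n p + vecZ n q := by
  funext i; simp [vecZ, Polynomial.add_mod]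

open Polynomial in
theorem vecZ_C_mul (n : ℕ) [NeZero n] (c : ZMod 2) (p : Polynomial (ZMod 2)) :
    vecZ n (C c * p) = c • vecZ n p := by
  funext i
  have h1 := sd_monic n
  simp only [vecZ, Pi.smul_apply]
  rw [← modByMonic_eq_mod _ h1, ← modByMonic_eq_mod _ h1, ← smul_eq_C_mul, smul_modByMonic]
  simp

open Polynomial in
theorem vecZ_zero (n : ℕ) : vecZ n 0 = 0 := by
  funext i; simp [vecZ]

open Polynomial in
theorem vecZ_eq_of_dvd (n : ℕ) (p q : Polynomial (ZMod 2)) (h : X ^ n - 1 ∣ p - q) :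
    vecZ n p = vecZ n q := by
  funext i; simp [vecZ, Polynomial.mod_eq_of_dvd_sub h]

open Polynomial in
theorem vecZ_eq_zero_iff (n : ℕ) [NeZero n] (p : Polynomial (ZMod 2)) :
    vecZ n p = 0 ↔ X ^ n - 1 ∣ p := by
  constructor
  · intro h
    refine EuclideanDomain.mod_eq_zero.1 ?_
    have hd : (p % (X ^ n - 1)).degree < (n : WithBot ℕ) := by
      have := EuclideanDomain.mod_lt p (sd_monic n).ne_zero
      rw [← sd_degree n]; exact this
    ext k
    by_cases hk : k < n
    · have := congrFun h ⟨k, hk⟩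
      simpa [vecZ] using this
    · rw [coeff_zero]
      apply coeff_eq_zero_of_degree_lt
      exact lt_of_lt_of_le hd (by exact_mod_cast not_lt.mp hk)
  · intro h
    rw [vecZ_eq_of_dvd n p 0 (by simpa using h), vecZ_zero]

open Polynomial in
theorem vecZ_shift (n : ℕ) [NeZero n] (p : Polynomial (ZMod 2)) :
    (fun i => vecZ n p (i - 1)) = vecZ n (X * p) := by
  have hn : 0 < n := Nat.pos_of_ne_zero (NeZero.ne n)
  set m : Polynomial (ZMod 2) := X ^ n - 1 with hm
  have hmon : m.Monic := sd_monic n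
  have hdm : m.degree = n := sd_degree n
  set r := p % m with hr
  have hrd : r.degree < n := by
    rw [← hdm]; exact EuclideanDomain.mod_lt p hmon.ne_zero
  set s := X * r - C (r.coeff (n - 1)) * m with hs
  have hsd : s.degree < n := by
    rw [Polynomial.degree_lt_iff_coeff_zero]
    intro k hk
    obtain ⟨k, rfl⟩ : ∃ j, k = j + 1 := ⟨k - 1, by omega⟩
    rw [hs, coeff_sub, coeff_X_mul, coeff_C_mul, hm, coeff_sub, coeff_X_pow, coeff_one]
    by_cases hkn : k + 1 = n
    · subst hkn; simp
    · rw [if_neg hkn, coeff_eq_zero_of_degree_lt (lt_of_lt_of_le hrd (by exact_mod_cast (by omega)))]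
      simp
  have key : (X * p) % m = s := by
    have h1 : (X * p) % m = s % m := by
      apply Polynomial.mod_eq_of_dvd_sub
      have h2 : m * (p / m) + r = p := EuclideanDomain.div_add_mod p m
      refine ⟨X * (p / m) + C (r.coeff (n - 1)), ?_⟩
      rw [hs]
      linear_combination (-X) * h2
    rw [h1]
    rw [Polynomial.mod_eq_self_iff hmon.ne_zero, hdm]; exact hsd
  funext i
  show r.coeff ((i - 1 : Fin n) : ℕ) = ((X * p) % m).coeff i
  rw [key, hs]
  obtain ⟨i, hi⟩ := i
  rcases Nat.eq_zero_or_pos i with rfl | hpos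
  · have : ((⟨0, hi⟩ - 1 : Fin n) : ℕ) = n - 1 := by
      rw [Fin.sub_def]
      simp only [Fin.val_one']
      rcases Nat.lt_or_ge 1 n with h | h
      · rw [Nat.mod_eq_of_lt h]; simp
      · have : n = 1 := by omega
        subst this; simp
    rw [this]
    simp [hm, coeff_X_pow, hn.ne]
  · have : ((⟨i, hi⟩ - 1 : Fin n) : ℕ) = i - 1 := by
      rw [Fin.sub_def]
      simp only [Fin.val_one']
      rw [Nat.mod_eq_of_lt (by omega : 1 < n)]
      rw [show n - 1 + i = (i - 1) + n by omega, Nat.add_mod_right, Nat.mod_eq_of_lt (by omega)]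
    rw [this]
    obtain ⟨j, rfl⟩ : ∃ j, i = j + 1 := ⟨i - 1, by omega⟩
    simp [hm, coeff_X_pow, coeff_one, hi.ne]

theorem vecR_fst (n : ℕ) (g a : Polynomial (ZMod 2)) (j : Fin n) :
    (vecR n g a j).fst = vecZ n g j := by simp [vecR, vecZ]

theorem vecR_snd (n : ℕ) (g a : Polynomial (ZMod 2)) (j : Fin n) :
    (vecR n g a j).snd = vecZ n a j := by simp [vecR, vecZ]

/-- codeword of a triple of polynomials -/
noncomputable def cw (α β : ℕ) (s g a : Polynomial (ZMod 2)) : Amb α β :=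
  (vecZ α s, vecR β g a)

theorem cw_add (α β : ℕ) (s g a s' g' a' : Polynomial (ZMod 2)) :
    cw α β s g a + cw α β s' g' a' = cw α β (s + s') (g + g') (a + a') := by
  refine Prod.ext (vecZ_add _ _ _).symm ?_
  funext j
  refine TrivSqZeroExt.ext ?_ ?_
  · simp [cw, vecR_fst, vecZ_add]
  · simp [cw, vecR_snd, vecZ_add]

theorem cw_zero (α β : ℕ) : cw α β 0 0 0 = 0 := by
  refine Prod.ext (vecZ_zero _) ?_
  funext j
  refine TrivSqZeroExt.ext ?_ ?_
  · simp [cw, vecR_fst, vecZ_zero]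
  · simp [cw, vecR_snd, vecZ_zero]

open Polynomial in
theorem cw_rsmul (α β : ℕ) [NeZero α] [NeZero β] (r : R2) (s g a : Polynomial (ZMod 2)) :
    rsmul r (cw α β s g a) = cw α β (C r.fst * s) (C r.fst * g) (C r.fst * a + C r.snd * g) := by
  refine Prod.ext ?_ ?_
  · funext i; simp [cw, rsmul, vecZ_C_mul]
  funext j
  refine TrivSqZeroExt.ext ?_ ?_
  · simp [cw, rsmul, vecR_fst, vecZ_C_mul]
  · simp [cw, rsmul, vecR_fst, vecR_snd, vecZ_C_mul, vecZ_add]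

open Polynomial in
theorem cw_shift (α β : ℕ) [NeZero α] [NeZero β] (s g a : Polynomial (ZMod 2)) :
    shiftT (cw α β s g a) = cw α β (X * s) (X * g) (X * a) := by
  refine Prod.ext (vecZ_shift _ _) ?_
  funext j
  refine TrivSqZeroExt.ext ?_ ?_
  · simp only [cw, shiftT, vecR_fst, ← vecZ_shift]
  · simp only [cw, shiftT, vecR_snd, ← vecZ_shift]

open Polynomial in
theorem cw_poly_mem {α β : ℕ} [NeZero α] [NeZero β] {D : Set (Amb α β)} (hD : IsCyclicCode D)
    {s g a : Polynomial (ZMod 2)} (h : cw α β s g a ∈ D) (p : Polynomial (ZMod 2)) :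
    cw α β (p * s) (p * g) (p * a) ∈ D := by
  obtain ⟨⟨h0, hadd, hsm⟩, hsh⟩ := hD
  induction p using Polynomial.induction_on' with
  | add p q hp hq =>
    have := hadd _ hp _ hq
    rw [cw_add] at this
    simpa only [add_mul] using this
  | monomial n c =>
    have hX : cw α β (X ^ n * s) (X ^ n * g) (X ^ n * a) ∈ D := by
      induction n with
      | zero => simpa using h
      | succ n ih =>
        have := hsh _ ih
        rw [cw_shift] at this
        simpa only [pow_succ', mul_assoc] using this
    have := hsm (inl c) _ hX
    rw [cw_rsmul] at this
    simpa [← C_mul_X_pow_eq_monomial, mul_assoc] using this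

/-- explicit form of the generated code -/
def spanSet (α β : ℕ) (f l g a : Polynomial (ZMod 2)) : Set (Amb α β) :=
  {v | ∃ p q q' : Polynomial (ZMod 2), v = cw α β (p * f + q * l) (q * g) (q * a + q' * g)}

theorem cw_f (α β : ℕ) (f : Polynomial (ZMod 2)) :
    ((vecZ α f, 0) : Amb α β) = cw α β f 0 0 := by
  refine Prod.ext rfl ?_
  funext j
  refine TrivSqZeroExt.ext ?_ ?_
  · simp [cw, vecR_fst, vecZ_zero]
  · simp [cw, vecR_snd, vecZ_zero]

open Polynomial in
theorem span_eq (α β : ℕ) [NeZero α] [NeZero β] (f l g a : Polynomial (ZMod 2)) :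
    cyclicSpan {((vecZ α f, 0) : Amb α β), (vecZ α l, vecR β g a)} = spanSet α β f l g a := by
  apply Set.Subset.antisymm
  · apply Set.sInter_subset_of_mem
    refine ⟨⟨⟨⟨0, 0, 0, ?_⟩, ?_, ?_⟩, ?_⟩, ?_⟩
    · simp [cw_zero]
    · rintro _ ⟨p, q, q', rfl⟩ _ ⟨p1, q1, q1', rfl⟩
      refine ⟨p + p1, q + q1, q' + q1', ?_⟩
      rw [cw_add]; congr 1 <;> ring
    · rintro r _ ⟨p, q, q', rfl⟩
      refine ⟨C r.fst * p, C r.fst * q, C r.fst * q' + C r.snd * q, ?_⟩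
      rw [cw_rsmul]; congr 1 <;> ring
    · rintro _ ⟨p, q, q', rfl⟩
      refine ⟨X * p, X * q, X * q', ?_⟩
      rw [cw_shift]; congr 1 <;> ring
    · rintro v (rfl | rfl)
      · exact ⟨1, 0, 0, by simp [cw_f]⟩
      · exact ⟨0, 1, 0, by simp [cw]⟩
  · rintro _ ⟨p, q, q', rfl⟩ D ⟨hD, hG⟩
    have h1 : cw α β f 0 0 ∈ D := by rw [← cw_f]; exact hG (by simp)
    have h2 : cw α β l g a ∈ D := hG (by simp [cw])
    have h3 := hD.1.2.2 DualNumber.eps _ h2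
    rw [cw_rsmul] at h3
    have h4 := hD.1.2.1 _ (hD.1.2.1 _ (cw_poly_mem hD h1 p) _ (cw_poly_mem hD h2 q)) _
      (cw_poly_mem hD h3 q')
    rw [cw_add, cw_add] at h4
    simpa using h4

/-- multiples of `d` as vectors -/
noncomputable def multMap (n k : ℕ) [NeZero n] (d : Polynomial (ZMod 2)) :
    Polynomial.degreeLT (ZMod 2) k →ₗ[ZMod 2] (Fin n → ZMod 2) where
  toFun q := vecZ n (d * q.1)
  map_add' x y := by simp [mul_add, vecZ_add]
  map_smul' c x := by
    simp only [Submodule.coe_smul, RingHom.id_apply]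
    rw [← vecZ_C_mul, Polynomial.smul_eq_C_mul, mul_left_comm]

open Polynomial in
theorem finrank_mult (n : ℕ) [NeZero n] (d : Polynomial (ZMod 2)) (hd : d ∣ X ^ n - 1)
    (A : Submodule (ZMod 2) (Fin n → ZMod 2)) (hA : ∀ x, x ∈ A ↔ ∃ s, x = vecZ n (d * s)) :
    Module.finrank (ZMod 2) A + d.natDegree = n := by
  obtain ⟨e, he⟩ := hd
  have hm0 := (sd_monic n).ne_zero
  have hd0 : d ≠ 0 := by rintro rfl; simp [he] at hm0
  have he0 : e ≠ 0 := by rintro rfl; simp [he] at hm0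
  have hdeg : d.natDegree + e.natDegree = n := by
    rw [← natDegree_mul hd0 he0, ← he]
    exact natDegree_eq_of_degree_eq_some (sd_degree n)
  have hr : A = LinearMap.range (multMap n e.natDegree d) := by
    ext x
    rw [hA]
    constructor
    · rintro ⟨s, rfl⟩
      refine ⟨⟨s % e, ?_⟩, ?_⟩
      · rw [mem_degreeLT, ← degree_eq_natDegree he0]
        exact EuclideanDomain.mod_lt s he0
      · apply vecZ_eq_of_dvd
        refine ⟨-(s / e), ?_⟩
        rw [he]
        linear_combination d * (EuclideanDomain.div_add_mod s e)
    · rintro ⟨q, rfl⟩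
      exact ⟨q, rfl⟩
  have hinj : Function.Injective (multMap n e.natDegree d) := by
    rw [← LinearMap.ker_eq_bot, LinearMap.ker_eq_bot']
    rintro ⟨q, hq⟩ h
    have h' : X ^ n - 1 ∣ d * q := (vecZ_eq_zero_iff n _).1 h
    rw [he] at h'
    have h2 := (mul_dvd_mul_iff_left hd0).1 h'
    rw [mem_degreeLT, ← degree_eq_natDegree he0] at hq
    have := eq_zero_of_dvd_of_degree_lt h2 hq
    simp [this]
  rw [hr, LinearMap.finrank_range_of_inj hinj, (degreeLTEquiv (ZMod 2) e.natDegree).finrank_eq]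
  simp; omega

theorem innerP_fst {α β : ℕ} (V W : Amb α β) :
    (innerP V W).fst = ∑ j, (V.2 j).fst * (W.2 j).fst := by
  simp [innerP, TrivSqZeroExt.fst_sum]

theorem innerP_snd {α β : ℕ} (V W : Amb α β) :
    (innerP V W).snd = ∑ i, V.1 i * W.1 i
      + ∑ j, ((V.2 j).fst * (W.2 j).snd + (V.2 j).snd * (W.2 j).fst) := by
  simp [innerP, TrivSqZeroExt.snd_sum, mul_comm]

/-- the scalar form on the ambient space -/
def bform (α β : ℕ) : LinearMap.BilinForm (ZMod 2) (Amb α β) :=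
  LinearMap.mk₂ (ZMod 2) (fun V W => (innerP V W).snd)
    (by intro V V' W
        simp only [innerP_snd, Prod.fst_add, Prod.snd_add, Pi.add_apply, TrivSqZeroExt.fst_add,
          TrivSqZeroExt.snd_add, add_mul, Finset.sum_add_distrib]
        ring)
    (by intro c V W
        simp only [innerP_snd, Prod.smul_fst, Prod.smul_snd, Pi.smul_apply, TrivSqZeroExt.fst_smul,
          TrivSqZeroExt.snd_smul, smul_eq_mul, mul_add, Finset.mul_sum, mul_assoc])
    (by intro V W W'
        simp only [innerP_snd, Prod.fst_add, Prod.snd_add, Pi.add_apply, TrivSqZeroExt.fst_add,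
          TrivSqZeroExt.snd_add, mul_add, Finset.sum_add_distrib]
        ring)
    (by intro c V W
        simp only [innerP_snd, Prod.smul_fst, Prod.smul_snd, Pi.smul_apply, TrivSqZeroExt.fst_smul,
          TrivSqZeroExt.snd_smul, smul_eq_mul, mul_add, Finset.mul_sum, mul_left_comm])

theorem bform_apply {α β : ℕ} (V W : Amb α β) : bform α β V W = (innerP V W).snd := rfl

theorem bform_symm {α β : ℕ} (V W : Amb α β) : bform α β V W = bform α β W V := by
  simp only [bform_apply, innerP_snd]
  congr 1
  · exact Finset.sum_congr rfl fun i _ => mul_comm _ _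
  · exact Finset.sum_congr rfl fun i _ => by ring

theorem bform_refl (α β : ℕ) : (bform α β).IsRefl := fun V W h => by
  rw [bform_symm]; exact h

theorem bform_left {α β : ℕ} (V : Amb α β) (h : ∀ W, bform α β V W = 0) : V = 0 := by
  refine Prod.ext ?_ ?_
  · funext i
    have := h (Pi.single i 1, 0)
    simpa [bform_apply, innerP_snd, Pi.single_apply] using this
  · funext j
    refine TrivSqZeroExt.ext ?_ ?_
    · have := h (0, Pi.single j (inr 1))
      rw [bform_apply, innerP_snd, Finset.sum_eq_single_of_mem (s := Finset.univ) j] at this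
      all_goals simp_all [Pi.single_apply]
    · have := h (0, Pi.single j 1)
      rw [bform_apply, innerP_snd, Finset.sum_eq_single_of_mem (s := Finset.univ) j] at this
      all_goals simp_all [Pi.single_apply]

theorem bform_nondeg (α β : ℕ) : (bform α β).Nondegenerate :=
  ⟨fun V h => bform_left V h, fun V h => bform_left V fun W => by rw [bform_symm]; exact h W⟩

/-- dot product -/
def dform (n : ℕ) : LinearMap.BilinForm (ZMod 2) (Fin n → ZMod 2) :=
  LinearMap.mk₂ (ZMod 2) (fun V W => ∑ i, V i * W i)
    (by intro V V' W; simp [add_mul, Finset.sum_add_distrib])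
    (by intro c V W; simp [Finset.mul_sum, mul_assoc])
    (by intro V V' W; simp [mul_add, Finset.sum_add_distrib])
    (by intro c V W; simp [Finset.mul_sum, mul_left_comm])

theorem dform_apply {n : ℕ} (V W : Fin n → ZMod 2) : dform n V W = ∑ i, V i * W i := rfl

theorem dform_nondeg (n : ℕ) : (dform n).Nondegenerate := by
  constructor
  · intro V h
    funext i
    simpa [dform_apply, Pi.single_apply] using h (Pi.single i 1)
  · intro V h
    funext i
    simpa [dform_apply, Pi.single_apply] using h (Pi.single i 1)

/-- a linear code as a subspace -/
def codeSub {α β : ℕ} (C : Set (Amb α β)) (h : IsLinearCode C) : Submodule (ZMod 2) (Amb α β) where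
  carrier := C
  zero_mem' := h.1
  add_mem' := fun hx hy => h.2.1 _ hx _ hy
  smul_mem' := fun c x hx => by
    have := h.2.2 (inl c) x hx
    convert this using 1
    refine Prod.ext ?_ ?_
    · funext i; simp [rsmul]
    · funext j
      refine TrivSqZeroExt.ext ?_ ?_ <;> simp [rsmul]

/-- vectors `(0, u b)` -/
def uSub (α β : ℕ) : Submodule (ZMod 2) (Amb α β) where
  carrier := {v | v.1 = 0 ∧ ∀ j, (v.2 j).fst = 0}
  zero_mem' := by simp
  add_mem' := fun hx hy => by
    refine ⟨by simp [hx.1, hy.1], fun j => by simp [hx.2 j, hy.2 j]⟩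
  smul_mem' := fun c x hx => by
    refine ⟨by simp [hx.1], fun j => by simp [hx.2 j]⟩

/-- vectors `(x, u b)` -/
def eSub (α β : ℕ) : Submodule (ZMod 2) (Amb α β) where
  carrier := {v | ∀ j, (v.2 j).fst = 0}
  zero_mem' := by simp
  add_mem' := fun hx hy j => by simp [hx j, hy j]
  smul_mem' := fun c x hx j => by simp [hx j]

theorem code_orth {α β : ℕ} (C : Set (Amb α β)) (h : IsLinearCode C) (hsd : C = dualCode C) :
    (bform α β).orthogonal (codeSub C h) = codeSub C h := by
  ext W
  rw [LinearMap.BilinForm.mem_orthogonal_iff]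
  constructor
  · intro hW
    show W ∈ C
    rw [hsd]
    intro V hV
    refine TrivSqZeroExt.ext ?_ (hW V hV)
    have := hW _ (h.2.2 DualNumber.eps V hV)
    rw [bform_apply, innerP_snd] at this
    rw [innerP_fst]
    simpa [rsmul] using this
  · intro hW V hV
    have hW' : W ∈ C := hW
    rw [hsd] at hW'
    rw [bform_apply, hW' V hV]; rfl

theorem uSub_orth (α β : ℕ) : (bform α β).orthogonal (uSub α β) ≤ eSub α β := by
  intro W hW j
  have := hW (0, Pi.single j (inr 1)) ⟨rfl, fun k => by
    by_cases hk : k = j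
    · subst hk; simp
    · simp [hk]⟩
  rw [bform_apply, innerP_snd, Finset.sum_eq_single_of_mem (s := Finset.univ) j] at this
  all_goals simp_all [Pi.single_apply]

theorem code_sup {α β : ℕ} (C : Set (Amb α β)) (h : IsLinearCode C) (hsd : C = dualCode C) :
    (bform α β).orthogonal (codeSub C h ⊓ eSub α β) ≤ codeSub C h ⊔ uSub α β := by
  have : Finite R2 := inferInstanceAs (Finite (ZMod 2 × ZMod 2))
  have : FiniteDimensional (ZMod 2) (Amb α β) := Module.Finite.of_finite
  rw [← LinearMap.BilinForm.orthogonal_orthogonal (bform_nondeg α β) (bform_refl α β)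
    (codeSub C h ⊔ uSub α β)]
  apply LinearMap.BilinForm.orthogonal_le
  refine le_inf ?_ ?_
  · conv_rhs => rw [← code_orth C h hsd]
    exact LinearMap.BilinForm.orthogonal_le le_sup_left
  · exact (LinearMap.BilinForm.orthogonal_le le_sup_right).trans (uSub_orth α β)

theorem proj_orth {α β : ℕ} (C : Set (Amb α β)) (h : IsLinearCode C) (hsd : C = dualCode C) :
    (dform α).orthogonal ((codeSub C h ⊓ eSub α β).map (LinearMap.fst (ZMod 2) _ _))
      = (codeSub C h ⊓ eSub α β).map (LinearMap.fst (ZMod 2) _ _) := by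
  ext y
  rw [LinearMap.BilinForm.mem_orthogonal_iff]
  constructor
  · intro hy
    have h1 : ((y, 0) : Amb α β) ∈ codeSub C h ⊔ uSub α β := by
      apply code_sup C h hsd
      intro V hV
      have := hy V.1 ⟨V, hV, rfl⟩
      rw [dform_apply] at this
      show bform α β V (y, 0) = 0
      rw [bform_apply, innerP_snd]
      simpa using this
    obtain ⟨c, hc, w, hw, hcw⟩ := Submodule.mem_sup.1 h1
    refine ⟨c, ⟨hc, fun j => ?_⟩, ?_⟩
    · have := congrArg TrivSqZeroExt.fst (congrFun (congrArg Prod.snd hcw) j)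
      simpa [hw.2 j] using this
    · have := congrArg Prod.fst hcw
      simpa [hw.1] using this
  · rintro ⟨W, ⟨hW, hWe⟩, rfl⟩ _ ⟨V, ⟨hV, hVe⟩, rfl⟩
    have hW' : W ∈ (bform α β).orthogonal (codeSub C h) := by rw [code_orth C h hsd]; exact hW
    have h2 : bform α β V W = 0 := hW' V hV
    rw [bform_apply, innerP_snd] at h2
    have hVe' : ∀ j, (V.2 j).fst = 0 := hVe
    have hWe' : ∀ j, (W.2 j).fst = 0 := hWe
    rw [dform_apply]
    simpa [hVe', hWe'] using h2

open Polynomial in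
/-- If `C = ⟨(f,0),(l,g+ua)⟩` is a self-dual `Z₂Z₂[u]`-cyclic code in
`R_{α,β}`, then `α = 2·deg d₁` where `d₁ = gcd(f, ((x^β−1)/g)·l)`;
in particular `α` is even. -/
theorem self_dual_alpha_eq_two_t4 (α β : ℕ) [NeZero α] [NeZero β] (hβ : Odd β)
    (f l g a : Polynomial (ZMod 2))
    (hf : f ∣ X ^ α - 1) (hag : a ∣ g) (hg : g ∣ X ^ β - 1)
    (hl : l.degree < f.degree)
    (hfl : f ∣ ((X ^ β - 1) / a) * l)
    (hfl' : ¬ ((X ^ α - 1) ∣ ((X ^ β - 1) / a) * l - f))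
    (C : Set (Amb α β))
    (hC : C = cyclicSpan {(vecZ α f, 0), (vecZ α l, vecR β g a)})
    (hsd : C = dualCode C) :
    α = 2 * (EuclideanDomain.gcd f (((X ^ β - 1) / g) * l)).natDegree ∧ Even α := by
  have hlin : IsLinearCode C := by
    rw [hC]
    refine ⟨fun D hD => hD.1.1.1, fun v hv w hw D hD => hD.1.1.2.1 _ (hv D hD) _ (hw D hD),
      fun r v hv D hD => hD.1.1.2.2 r v (hv D hD)⟩
  have hCs : C = spanSet α β f l g a := by rw [hC, span_eq]
  set h := (X ^ β - 1) / g with hh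
  set d := EuclideanDomain.gcd f (h * l) with hd
  have hm0 := (sd_monic β).ne_zero
  have hg0 : g ≠ 0 := by rintro rfl; exact hm0 (zero_dvd_iff.1 hg)
  have hgh : X ^ β - 1 = g * h := (EuclideanDomain.mul_div_cancel' hg0 hg).symm
  have hdf : d ∣ f := EuclideanDomain.gcd_dvd_left _ _
  have hdl : d ∣ h * l := EuclideanDomain.gcd_dvd_right _ _
  have horth := proj_orth C hlin hsd
  set A := (codeSub C hlin ⊓ eSub α β).map (LinearMap.fst (ZMod 2) _ _) with hA
  have hmem : ∀ x, x ∈ A ↔ ∃ s, x = vecZ α (d * s) := by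
    intro x
    constructor
    · rintro ⟨v, ⟨hv, hve⟩, rfl⟩
      have hv' : v ∈ C := hv
      rw [hCs] at hv'
      obtain ⟨p, q, q', rfl⟩ := hv'
      have hz : vecZ β (q * g) = 0 := by
        funext j
        rw [← vecR_fst β (q * g) (q * a + q' * g) j]
        exact hve j
      rw [vecZ_eq_zero_iff, hgh, mul_comm g h] at hz
      obtain ⟨t, rfl⟩ := (mul_dvd_mul_iff_right hg0).1 hz
      have : d ∣ p * f + h * t * l := by
        refine dvd_add (hdf.mul_left p) ?_
        rw [mul_right_comm]
        exact hdl.mul_right t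
      obtain ⟨s, hs⟩ := this
      exact ⟨s, by rw [← hs]; rfl⟩
    · rintro ⟨s, rfl⟩
      have hb := EuclideanDomain.gcd_eq_gcd_ab f (h * l)
      rw [← hd] at hb
      set p := EuclideanDomain.gcdA f (h * l)
      set q := EuclideanDomain.gcdB f (h * l)
      refine ⟨cw α β (s * p * f + s * q * h * l) (s * q * h * g) (s * q * h * a + 0 * g),
        ⟨?_, ?_⟩, ?_⟩
      · show _ ∈ C
        rw [hCs]
        exact ⟨_, _, _, rfl⟩
      · intro j
        show (vecR β _ _ j).fst = 0
        rw [vecR_fst, (vecZ_eq_zero_iff β _).2 ⟨s * q, by rw [hgh]; ring⟩]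
        rfl
      · show vecZ α _ = _
        congr 1
        rw [hb]; ring
  have h1 := finrank_mult α d (hdf.trans hf) A hmem
  have h2 := LinearMap.BilinForm.finrank_orthogonal (dform_nondeg α) A
  rw [horth] at h2
  simp only [Module.finrank_fintype_fun_eq_card, Fintype.card_fin] at h2
  have h3 : α = 2 * d.natDegree := by omega
  exact ⟨h3, ⟨d.natDegree, by omega⟩⟩
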